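/- Let D, D' be division rings which possess involutions σ and σ' respectively, both subject to restrictions (R1) and (R2), and let n, n' be integers ≥ 2. If φ : H_n(D) → H_{n'}(D') is a surjection satisfying, for all A, B ∈ H_n(D), rank(A − B) = n if and only if rank(A^φ − B^φ) = n', then φ is bijective, both φ and φ⁻¹ preserve adjacency of Hermitian matrices (i.e. rank(A − B) = 1 if and only if rank(A^φ − B^φ) = 1), and n = n'. -/

import Mathlib

/-- The left row rank of a matrix over a division ring `D`: the dimension of the
subspace of the left vector space `D^n` spanned by the rows. -/
noncomputable def rowRank {D : Type*} [DivisionRing D] {m n : ℕ}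
    (A : Matrix (Fin m) (Fin n) D) : ℕ :=
  Module.finrank D (Submodule.span D (Set.range fun i => A i))

section RowRank

open Matrix

variable {D : Type*} [DivisionRing D] {m n : ℕ}

theorem rowRank_eq_finrank_range (A : Matrix (Fin m) (Fin n) D) :
    rowRank A = Module.finrank D (LinearMap.range (vecMulLinear A)) := by
  have h : LinearMap.range (vecMulLinear A) =
      Submodule.span D (Set.range fun i => A i) := by
    apply le_antisymm
    · rintro _ ⟨v, rfl⟩
      rw [vecMulLinear_apply, vecMul_eq_sum]
      exact Submodule.sum_mem _ fun i _ =>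
        Submodule.smul_mem _ _ (Submodule.subset_span ⟨i, rfl⟩)
    · rw [Submodule.span_le]
      rintro _ ⟨i, rfl⟩
      exact ⟨Pi.single i 1, by simp [Matrix.row]⟩
  rw [rowRank, h]

theorem rowRank_eq_card_iff {A : Matrix (Fin n) (Fin n) D} :
    rowRank A = n ↔ ∀ v, v ᵥ* A = 0 → v = 0 := by
  have h := LinearMap.finrank_range_add_finrank_ker (vecMulLinear A)
  rw [Module.finrank_fin_fun] at h
  have h2 : rowRank A = n ↔ Module.finrank D (LinearMap.ker (vecMulLinear A)) = 0 := by
    rw [rowRank_eq_finrank_range]; omega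
  rw [h2, Submodule.finrank_eq_zero, LinearMap.ker_eq_bot']
  rfl

theorem rowRank_ne_card_iff {A : Matrix (Fin n) (Fin n) D} :
    rowRank A ≠ n ↔ ∃ v, v ≠ 0 ∧ v ᵥ* A = 0 := by
  rw [Ne, rowRank_eq_card_iff]
  push Not
  exact exists_congr fun v => and_comm

theorem rowRank_eq_one_iff {A : Matrix (Fin m) (Fin n) D} :
    rowRank A = 1 ↔ ∃ w, w ᵥ* A ≠ 0 ∧ ∀ v, ∃ c : D, v ᵥ* A = c • (w ᵥ* A) := by
  rw [rowRank_eq_finrank_range, finrank_eq_one_iff']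
  constructor
  · rintro ⟨⟨_, w, rfl⟩, hw, h⟩
    refine ⟨w, fun h0 => hw (Subtype.ext h0), fun v => ?_⟩
    obtain ⟨c, hc⟩ := h ⟨_, v, rfl⟩
    exact ⟨c, (congrArg Subtype.val hc).symm⟩
  · rintro ⟨w, hw, h⟩
    refine ⟨⟨_, w, rfl⟩, fun h0 => hw (congrArg Subtype.val h0), ?_⟩
    rintro ⟨_, v, rfl⟩
    obtain ⟨c, hc⟩ := h v
    exact ⟨c, Subtype.ext hc.symm⟩

theorem rowRank_zero : rowRank (0 : Matrix (Fin m) (Fin n) D) = 0 := by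
  have h : vecMulLinear (0 : Matrix (Fin m) (Fin n) D) = 0 := by ext; simp
  rw [rowRank_eq_finrank_range, h]
  simp

theorem rowRank_add_le (A B : Matrix (Fin m) (Fin n) D) :
    rowRank (A + B) ≤ rowRank A + rowRank B := by
  simp only [rowRank_eq_finrank_range]
  refine le_trans (Submodule.finrank_mono ?_)
    (Submodule.finrank_add_le_finrank_add_finrank _ _)
  rintro _ ⟨v, rfl⟩
  rw [vecMulLinear_apply, vecMul_add]
  exact Submodule.add_mem_sup ⟨v, rfl⟩ ⟨v, rfl⟩

theorem rowRank_sub_le_of_chain (f : ℕ → Matrix (Fin m) (Fin n) D) (k : ℕ)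
    (h : ∀ i < k, rowRank (f (i + 1) - f i) = 1) : rowRank (f k - f 0) ≤ k := by
  induction k with
  | zero => rw [sub_self, rowRank_zero]
  | succ k ih =>
    rw [← sub_add_sub_cancel (f (k + 1)) (f k) (f 0)]
    have := rowRank_add_le (f (k + 1) - f k) (f k - f 0)
    have := ih fun i hi => h i (by omega)
    have := h k (by omega)
    omega

/-- A kernel inclusion gives a factorization. -/
theorem exists_eq_mul_of_vecMul_eq_zero {A B : Matrix (Fin n) (Fin n) D}
    (h : ∀ v, v ᵥ* B = 0 → v ᵥ* A = 0) : ∃ T : Matrix (Fin n) (Fin n) D, A = B * T := by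
  let f : LinearMap.range (vecMulLinear B) →ₗ[D] (Fin n → D) :=
    (LinearMap.ker (vecMulLinear B)).liftQ (vecMulLinear A) h ∘ₗ
      (vecMulLinear B).quotKerEquivRange.symm.toLinearMap
  obtain ⟨g, hg⟩ := LinearMap.exists_extend f
  have hgv : ∀ v, g (v ᵥ* B) = v ᵥ* A := fun v => by
    have h1 := LinearMap.congr_fun hg ⟨_, v, rfl⟩
    have h2 : (vecMulLinear B).quotKerEquivRange.symm ⟨vecMulLinear B v, v, rfl⟩ =
        Submodule.Quotient.mk v := by
      rw [LinearEquiv.symm_apply_eq]; rfl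
    simp only [f, LinearMap.comp_apply, LinearEquiv.coe_coe, h2] at h1
    exact h1
  refine ⟨LinearMap.toMatrixRight' g, ?_⟩
  have hT : ∀ v, v ᵥ* LinearMap.toMatrixRight' g = g v := fun v =>
    LinearMap.congr_fun (LinearMap.toMatrixRight'.symm_apply_apply g) v
  apply Matrix.ext_of_single_vecMul
  intro i
  rw [← vecMul_vecMul, hT, hgv]

end RowRank

section Hermitian

open Matrix

variable {D : Type*} [DivisionRing D] [StarRing D] {n : ℕ}

/-- The sesquilinear form with Gram matrix `A`. -/
def sesqForm (A : Matrix (Fin n) (Fin n) D) (v w : Fin n → D) : D := v ᵥ* A ⬝ᵥ star w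

namespace sesqForm

variable (A B : Matrix (Fin n) (Fin n) D) (u v w : Fin n → D) (c : D)

theorem add_left : sesqForm A (u + v) w = sesqForm A u w + sesqForm A v w := by
  simp [sesqForm, add_vecMul]

theorem add_right : sesqForm A u (v + w) = sesqForm A u v + sesqForm A u w := by
  simp [sesqForm]

theorem smul_left : sesqForm A (c • v) w = c * sesqForm A v w := by
  simp [sesqForm, smul_vecMul]

theorem smul_right : sesqForm A v (c • w) = sesqForm A v w * star c := by
  simp [sesqForm, dotProduct, Finset.sum_mul, mul_assoc]

theorem sub_right : sesqForm A u (v - w) = sesqForm A u v - sesqForm A u w := by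
  simp [sesqForm]

theorem sub_matrix : sesqForm (A - B) v w = sesqForm A v w - sesqForm B v w := by
  simp [sesqForm, vecMul_sub, sub_dotProduct]

theorem add_matrix : sesqForm (A + B) v w = sesqForm A v w + sesqForm B v w := by
  simp [sesqForm, vecMul_add, add_dotProduct]

variable {A B u v w c}

theorem star_eq (hA : A.IsHermitian) : star (sesqForm A v w) = sesqForm A w v := by
  unfold sesqForm
  rw [← star_dotProduct_star, star_star, star_vecMul, hA.eq, dotProduct_mulVec]

theorem eq_zero_comm (hA : A.IsHermitian) : sesqForm A v w = 0 ↔ sesqForm A w v = 0 := by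
  rw [← star_eq hA, star_eq_zero]

theorem eq_zero_of_vecMul_left (h : v ᵥ* A = 0) : sesqForm A v w = 0 := by
  simp [sesqForm, h]

theorem eq_zero_of_vecMul_right (hA : A.IsHermitian) (h : w ᵥ* A = 0) :
    sesqForm A v w = 0 := by
  rw [eq_zero_comm hA, eq_zero_of_vecMul_left h]

theorem vecMul_eq_zero (h : ∀ w, sesqForm A v w = 0) : v ᵥ* A = 0 := by
  ext i
  simpa [sesqForm, ← Pi.single_star] using h (Pi.single i 1)

theorem matrix_eq_zero (h : ∀ v w, sesqForm A v w = 0) : A = 0 := by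
  apply Matrix.ext_of_single_vecMul
  intro i
  rw [vecMul_eq_zero (h _), vecMul_zero]

/-- A nonzero Hermitian form is not alternating. -/
theorem exists_self_ne_zero (hD : (∀ x : D, star x = x) → (2 : D) ≠ 0)
    (hA : A.IsHermitian) (h0 : A ≠ 0) : ∃ w, sesqForm A w w ≠ 0 := by
  by_contra! h
  apply h0
  apply matrix_eq_zero
  intro v w
  by_contra ha
  have hneg : ∀ d : D, star d = -d := by
    intro d
    have hsum := h ((d * (sesqForm A v w)⁻¹) • v + w)
    rw [add_left, add_right, add_right, h, h, ← star_eq hA (v := _ • v), smul_left, mul_assoc,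
      inv_mul_cancel₀ ha, mul_one] at hsum
    rw [eq_neg_iff_add_eq_zero, add_comm]
    simpa using hsum
  have h1 : (1 : D) = -1 := by simpa using hneg 1
  have h2 : (2 : D) = 0 := by
    rw [← one_add_one_eq_two]
    exact eq_neg_iff_add_eq_zero.mp h1
  refine hD (fun x => ?_) h2
  rw [hneg, ← neg_one_mul, ← h1, one_mul]

theorem self_add_smul {t : D} (ht : star t = t) (htc : ∀ x, t * x = x * t) :
    sesqForm A (u + t • v) (u + t • v) =
      sesqForm A u u + t * (sesqForm A u v + sesqForm A v u) + t * t * sesqForm A v v := by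
  simp only [add_left, add_right, smul_left, smul_right, ht]
  rw [← htc]
  noncomm_ring

/-- Two nonzero Hermitian forms have a common anisotropic vector. -/
theorem exists_self_ne_zero_and (hD : (∀ x : D, star x = x) → (2 : D) ≠ 0)
    {s : Finset D} (hs : 3 < s.card) (hsc : ∀ t ∈ s, star t = t ∧ ∀ x, t * x = x * t)
    (hA : A.IsHermitian) (hB : B.IsHermitian) (hA0 : A ≠ 0) (hB0 : B ≠ 0) :
    ∃ w, sesqForm A w w ≠ 0 ∧ sesqForm B w w ≠ 0 := by
  classical
  obtain ⟨u, hu⟩ := exists_self_ne_zero hD hA hA0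
  obtain ⟨v, hv⟩ := exists_self_ne_zero hD hB hB0
  by_cases hAv : sesqForm A v v = 0
  swap; · exact ⟨v, hAv, hv⟩
  by_cases hBu : sesqForm B u u = 0
  swap; · exact ⟨u, hu, hBu⟩
  set a := sesqForm A u v + sesqForm A v u
  set b := sesqForm B u v + sesqForm B v u
  have h1 : (s.filter fun t => sesqForm A u u + t * a = 0).card ≤ 1 := by
    rw [Finset.card_le_one]
    simp only [Finset.mem_filter]
    rintro x ⟨-, hx⟩ y ⟨-, hy⟩
    have ha : a ≠ 0 := fun ha => hu (by simpa [ha] using hx)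
    exact mul_right_cancel₀ ha (add_left_cancel (hx.trans hy.symm))
  have h2 : (s.filter fun t => b + t * sesqForm B v v = 0).card ≤ 1 := by
    rw [Finset.card_le_one]
    simp only [Finset.mem_filter]
    rintro x ⟨-, hx⟩ y ⟨-, hy⟩
    exact mul_right_cancel₀ hv (add_left_cancel (hx.trans hy.symm))
  obtain ⟨t, hts, ht⟩ : ∃ t ∈ s, t ∉ {0} ∪ ((s.filter fun t => sesqForm A u u + t * a = 0) ∪
      s.filter fun t => b + t * sesqForm B v v = 0) := by
    apply Finset.exists_mem_notMem_of_card_lt_card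
    refine lt_of_le_of_lt (Finset.card_union_le _ _) ?_
    have := Finset.card_union_le (s.filter fun t => sesqForm A u u + t * a = 0)
      (s.filter fun t => b + t * sesqForm B v v = 0)
    rw [Finset.card_singleton]
    omega
  simp only [Finset.mem_union, Finset.mem_singleton, Finset.mem_filter, hts, true_and,
    not_or] at ht
  obtain ⟨ht0, htA, htB⟩ := ht
  obtain ⟨hst, hct⟩ := hsc t hts
  refine ⟨u + t • v, ?_, ?_⟩
  · rw [self_add_smul hst hct, hAv, mul_zero, add_zero]
    exact htA
  · rw [self_add_smul hst hct, hBu, zero_add, mul_assoc, ← mul_add]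
    exact mul_ne_zero ht0 htB

end sesqForm

theorem sesqForm_vecMulVec (x v w : Fin n → D) :
    sesqForm (vecMulVec (star x) x) v w = (v ⬝ᵥ star x) * star (w ⬝ᵥ star x) := by
  rw [sesqForm, vecMul_vecMulVec, smul_dotProduct, smul_eq_mul, dotProduct_star x w]

theorem isHermitian_vecMulVec_star_self (x : Fin n → D) :
    (vecMulVec (star x) x).IsHermitian := by
  rw [IsHermitian, conjTranspose_vecMulVec, star_star]

/-- A Hermitian matrix which is injective on a subspace can be made invertible without changing
its action on that subspace. -/
theorem exists_isHermitian_extension (U : Submodule D (Fin n → D))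
    {X : Matrix (Fin n) (Fin n) D} (hX : X.IsHermitian)
    (hU : ∀ u ∈ U, u ᵥ* X = 0 → u = 0) :
    ∃ Y : Matrix (Fin n) (Fin n) D, Y.IsHermitian ∧ (∀ u ∈ U, u ᵥ* Y = u ᵥ* X) ∧
      ∀ v, v ᵥ* Y = 0 → v = 0 := by
  induction hk : Module.finrank D (LinearMap.ker (vecMulLinear X)) using Nat.strong_induction_on
    generalizing X with
  | _ k ih =>
  by_cases h : ∀ v, v ᵥ* X = 0 → v = 0
  · exact ⟨X, hX, fun _ _ => rfl, h⟩
  push Not at h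
  obtain ⟨k, hkX, hk0⟩ := h
  have hkU : k ∉ U := fun hkU => hk0 (hU k hkU hkX)
  obtain ⟨f, hfk, hfU⟩ := Submodule.exists_le_ker_of_notMem hkU
  set x : Fin n → D := star fun i => f (Pi.single i 1)
  have hx : ∀ v, v ⬝ᵥ star x = f v := by
    intro v
    conv_rhs => rw [pi_eq_sum_univ' v]
    simp [x, dotProduct]
  set P := vecMulVec (star x) x
  have hP : ∀ v, v ᵥ* P = f v • x := fun v => by rw [vecMul_vecMulVec, hx]
  have hPU : ∀ u ∈ U, u ᵥ* (X + P) = u ᵥ* X := fun u hu => by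
    rw [vecMul_add, hP, LinearMap.mem_ker.mp (hfU hu), zero_smul, add_zero]
  have hker : ∀ v, v ᵥ* (X + P) = 0 → v ᵥ* X = 0 ∧ f v = 0 := by
    intro v hv
    have h1 : sesqForm (X + P) v k = 0 := sesqForm.eq_zero_of_vecMul_left hv
    rw [sesqForm.add_matrix, sesqForm.eq_zero_of_vecMul_right hX hkX, zero_add,
      sesqForm_vecMulVec, hx, hx] at h1
    have h2 : f v = 0 := (mul_eq_zero.mp h1).resolve_right (by simpa using hfk)
    refine ⟨?_, h2⟩
    rwa [vecMul_add, hP, h2, zero_smul, add_zero] at hv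
  obtain ⟨Y, hY, hYU, hY0⟩ := ih _ (by
      rw [← hk]
      apply Submodule.finrank_lt_finrank_of_lt
      refine lt_of_le_of_ne (fun v hv => (hker v hv).1) fun heq => ?_
      have hmem : k ∈ LinearMap.ker (vecMulLinear (X + P)) := by rw [heq]; exact hkX
      exact hfk (hker k hmem).2) (hX.add (isHermitian_vecMulVec_star_self x))
    (fun u hu h0 => hU u hu (by rwa [hPU u hu] at h0)) rfl
  exact ⟨Y, hY, fun u hu => (hYU u hu).trans (hPU u hu), hY0⟩

theorem exists_isHermitian_of_ne_zero (hD : (∀ x : D, star x = x) → (2 : D) ≠ 0)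
    {A : Matrix (Fin n) (Fin n) D} (hA : A.IsHermitian) (h0 : A ≠ 0) :
    ∃ X : Matrix (Fin n) (Fin n) D, X.IsHermitian ∧ (∀ v, v ᵥ* X = 0 → v = 0) ∧
      ∃ w, w ≠ 0 ∧ w ᵥ* (X - A) = 0 := by
  obtain ⟨w, hw⟩ := sesqForm.exists_self_ne_zero hD hA h0
  have hwA : w ᵥ* A ≠ 0 := fun h => hw (sesqForm.eq_zero_of_vecMul_left h)
  obtain ⟨X, hX, hXU, hX0⟩ := exists_isHermitian_extension (Submodule.span D {w}) hA (by
    intro u hu h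
    obtain ⟨c, rfl⟩ := Submodule.mem_span_singleton.mp hu
    rw [smul_vecMul, smul_eq_zero] at h
    rw [h.resolve_right hwA, zero_smul])
  refine ⟨X, hX, hX0, w, ?_, ?_⟩
  · rintro rfl; simp at hwA
  · rw [vecMul_sub, hXU w (Submodule.mem_span_singleton_self w), sub_self]

theorem exists_isHermitian_of_orthogonal {A B : Matrix (Fin n) (Fin n) D}
    (hA : A.IsHermitian) (hB : B.IsHermitian) {w w' : Fin n → D}
    (hw : sesqForm (A - B) w w ≠ 0) (hww' : sesqForm (A - B) w w' = 0)
    (hwA : w ᵥ* A ≠ 0) (hwB : ∀ c : D, w' ᵥ* B ≠ c • (w ᵥ* A)) :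
    ∃ X : Matrix (Fin n) (Fin n) D, X.IsHermitian ∧ (∀ v, v ᵥ* X = 0 → v = 0) ∧
      (∃ v, v ≠ 0 ∧ v ᵥ* (X - A) = 0) ∧ ∃ v, v ≠ 0 ∧ v ᵥ* (X - B) = 0 := by
  have hC := hA.sub hB
  set C := A - B with hCdef
  set γ := sesqForm C w w
  set y := w ᵥ* C
  have hγ : star γ = γ := sesqForm.star_eq hC
  have hyw : ∀ v, v ⬝ᵥ star y = sesqForm C v w := by
    intro v
    rw [dotProduct_star]
    exact sesqForm.star_eq hC
  set X₀ := B + vecMulVec (star y) (γ⁻¹ • y)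
  have hv : ∀ v, v ᵥ* X₀ = v ᵥ* B + (sesqForm C v w * γ⁻¹) • y := by
    intro v
    rw [vecMul_add, vecMul_vecMulVec, hyw, smul_smul]
  have hX₀ : X₀.IsHermitian := by
    apply hB.add
    rw [IsHermitian, conjTranspose_vecMulVec, star_star]
    ext i j
    simp [vecMulVec_apply, hγ, mul_assoc]
  have hw₀ : w ᵥ* X₀ = w ᵥ* A := by
    rw [hv, mul_inv_cancel₀ hw, one_smul, ← vecMul_add, hCdef, add_sub_cancel]
  have hw₀' : w' ᵥ* X₀ = w' ᵥ* B := by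
    rw [hv, (sesqForm.eq_zero_comm hC).mp hww', zero_mul, zero_smul, add_zero]
  obtain ⟨X, hX, hXU, hX0⟩ := exists_isHermitian_extension (Submodule.span D {w, w'}) hX₀ (by
    intro u hu h
    obtain ⟨c, d, rfl⟩ := Submodule.mem_span_pair.mp hu
    rw [add_vecMul, smul_vecMul, smul_vecMul, hw₀, hw₀'] at h
    have hd : d = 0 := by
      by_contra hd
      apply hwB (-(d⁻¹ * c))
      have h2 := congrArg (d⁻¹ • ·) h
      simp only [smul_add, smul_smul, inv_mul_cancel₀ hd, one_smul, smul_zero] at h2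
      rw [neg_smul]
      exact eq_neg_of_add_eq_zero_right h2
    rw [hd, zero_smul, add_zero, smul_eq_zero] at h
    rw [hd, h.resolve_right hwA, zero_smul, zero_smul, add_zero])
  refine ⟨X, hX, hX0, ⟨w, ?_, ?_⟩, w', ?_, ?_⟩
  · rintro rfl; simp at hwA
  · rw [vecMul_sub, hXU w (Submodule.subset_span (by simp)), hw₀, sub_self]
  · rintro rfl
    exact hwB 0 (by simp)
  · rw [vecMul_sub, hXU w' (Submodule.subset_span (by simp)), hw₀', sub_self]

theorem exists_isHermitian_of_ker_not_le
    (hD : (∀ x : D, star x = x) → (2 : D) ≠ 0)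
    {s : Finset D} (hs : 3 < s.card) (hsc : ∀ t ∈ s, star t = t ∧ ∀ x, t * x = x * t)
    {A B : Matrix (Fin n) (Fin n) D} (hA : A.IsHermitian) (hB : B.IsHermitian)
    (hB0 : B ≠ 0) {x : Fin n → D}
    (hxB : x ᵥ* B = 0) (hxA : x ᵥ* A ≠ 0) :
    ∃ X : Matrix (Fin n) (Fin n) D, X.IsHermitian ∧ (∀ v, v ᵥ* X = 0 → v = 0) ∧
      (∃ v, v ≠ 0 ∧ v ᵥ* (X - A) = 0) ∧ ∃ v, v ≠ 0 ∧ v ᵥ* (X - B) = 0 := by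
  have hC := hA.sub hB
  have hC0 : A - B ≠ 0 := by
    intro h
    rw [sub_eq_zero.mp h] at hxA
    exact hxA hxB
  have hE : vecMulVec (star (x ᵥ* A)) (x ᵥ* A) ≠ 0 := by
    simpa [vecMulVec_eq_zero] using hxA
  obtain ⟨w, hwC, hwE⟩ := sesqForm.exists_self_ne_zero_and hD hs hsc hC
    (isHermitian_vecMulVec_star_self (x ᵥ* A)) hC0 hE
  rw [sesqForm_vecMulVec] at hwE
  have hwx : sesqForm A w x ≠ 0 := by
    rw [Ne, sesqForm.eq_zero_comm hA]
    intro h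
    apply left_ne_zero_of_mul hwE
    rw [dotProduct_star, star_eq_zero]
    exact h
  have hwxC : sesqForm (A - B) w x ≠ 0 := by
    rwa [sesqForm.sub_matrix, sesqForm.eq_zero_of_vecMul_right hB hxB, sub_zero]
  obtain ⟨v, hv⟩ : ∃ v, v ᵥ* B ≠ 0 := by
    by_contra! h
    exact hB0 (sesqForm.matrix_eq_zero fun v w => sesqForm.eq_zero_of_vecMul_left (h v))
  refine exists_isHermitian_of_orthogonal hA hB (w := w)
    (w' := v - star ((sesqForm (A - B) w x)⁻¹ * sesqForm (A - B) w v) • x) hwC ?_ ?_ ?_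
  · rw [sesqForm.sub_right, sesqForm.smul_right, star_star, mul_inv_cancel_left₀ hwxC, sub_self]
  · exact fun h => hwx (sesqForm.eq_zero_of_vecMul_left h)
  · intro c hc
    rw [sub_vecMul, smul_vecMul, hxB, smul_zero, sub_zero] at hc
    have h1 : sesqForm B v x = c * sesqForm A w x := by
      rw [sesqForm, hc, smul_dotProduct]; rfl
    rw [sesqForm.eq_zero_of_vecMul_right hB hxB, eq_comm, mul_eq_zero] at h1
    rw [h1.resolve_right hwx, zero_smul] at hc
    exact hv hc

theorem exists_isHermitian_of_ker_eq
    (hD : (∀ x : D, star x = x) → (2 : D) ≠ 0)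
    {s : Finset D} (hs : 3 < s.card) (hsc : ∀ t ∈ s, star t = t ∧ ∀ x, t * x = x * t)
    {A B : Matrix (Fin n) (Fin n) D} (hA : A.IsHermitian) (hB : B.IsHermitian)
    (hAB : A ≠ B)
    (hker : ∀ x, x ᵥ* A = 0 ↔ x ᵥ* B = 0) (h1 : rowRank (A - B) ≠ 1) :
    ∃ X : Matrix (Fin n) (Fin n) D, X.IsHermitian ∧ (∀ v, v ᵥ* X = 0 → v = 0) ∧
      (∃ v, v ≠ 0 ∧ v ᵥ* (X - A) = 0) ∧ ∃ v, v ≠ 0 ∧ v ᵥ* (X - B) = 0 := by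
  have hC := hA.sub hB
  have hC0 : A - B ≠ 0 := sub_ne_zero.mpr hAB
  obtain ⟨T, hT⟩ := exists_eq_mul_of_vecMul_eq_zero fun v => (hker v).mpr
  have hT' : Tᴴ * B = A := by
    rw [← hA.eq, hT, conjTranspose_mul, hB.eq]
  have hEeq : (A - B) * T = Tᴴ * B * T - A := by
    rw [sub_mul, ← hT, hT']
  have hE : ((A - B) * T).IsHermitian := by
    rw [hEeq]
    exact (isHermitian_conjTranspose_mul_mul T hB).sub hA
  have hE0 : (A - B) * T ≠ 0 := by
    intro h
    have h2 : (Tᴴ - 1) * A = 0 := by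
      have := congrArg conjTranspose h
      rwa [conjTranspose_mul, hC.eq, conjTranspose_zero, mul_sub, hT', ← sub_one_mul] at this
    apply hC0
    have h3 : (Tᴴ - 1) * B = 0 := by
      apply Matrix.ext_of_single_vecMul
      intro i
      rw [← vecMul_vecMul, vecMul_zero, ← hker, vecMul_vecMul, h2, vecMul_zero]
    rwa [sub_mul, one_mul, hT'] at h3
  obtain ⟨w, hwC, hwE⟩ := sesqForm.exists_self_ne_zero_and hD hs hsc hC hE hC0 hE0
  set h := w ᵥ* Tᴴ
  have hhB : h ᵥ* B = w ᵥ* A := by rw [vecMul_vecMul, hT']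
  have hwh : sesqForm (A - B) w h ≠ 0 := by
    rw [sesqForm, star_vecMul, conjTranspose_conjTranspose, dotProduct_mulVec, vecMul_vecMul]
    exact hwE
  have hwA : w ᵥ* A ≠ 0 := by
    intro h0
    have h0' := (hker w).mp h0
    apply hwC
    rw [sesqForm, vecMul_sub, h0, h0', sub_zero, zero_dotProduct]
  obtain ⟨v, hv⟩ : ∃ v, ∀ c : D, v ᵥ* B ≠ c • (w ᵥ* A) := by
    by_contra! hall
    have hCall : ∀ v, ∃ c : D, v ᵥ* (A - B) = c • (w ᵥ* A) := by
      intro v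
      obtain ⟨c, hc⟩ := hall (v ᵥ* Tᴴ)
      obtain ⟨d, hd⟩ := hall v
      rw [vecMul_vecMul, hT'] at hc
      exact ⟨c - d, by rw [vecMul_sub, hc, hd, sub_smul]⟩
    apply h1
    rw [rowRank_eq_one_iff]
    have hwC' : w ᵥ* (A - B) ≠ 0 := fun h => hwC (sesqForm.eq_zero_of_vecMul_left h)
    refine ⟨w, hwC', fun v => ?_⟩
    obtain ⟨c, hc⟩ := hCall v
    obtain ⟨d, hd⟩ := hCall w
    have hd0 : d ≠ 0 := by
      rintro rfl
      exact hwC' (by rw [hd, zero_smul])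
    exact ⟨c * d⁻¹, by rw [hc, hd, smul_smul, inv_mul_cancel_right₀ hd0]⟩
  refine exists_isHermitian_of_orthogonal hA hB (w := w)
    (w' := v - star ((sesqForm (A - B) w h)⁻¹ * sesqForm (A - B) w v) • h) hwC ?_ hwA ?_
  · rw [sesqForm.sub_right, sesqForm.smul_right, star_star, mul_inv_cancel_left₀ hwh, sub_self]
  · intro c hc
    rw [sub_vecMul, smul_vecMul, hhB, sub_eq_iff_eq_add, ← add_smul] at hc
    exact hv _ hc

theorem exists_isHermitian_of_rowRank_ne_one
    (hD : (∀ x : D, star x = x) → (2 : D) ≠ 0)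
    {s : Finset D} (hs : 3 < s.card) (hsc : ∀ t ∈ s, star t = t ∧ ∀ x, t * x = x * t)
    {A B : Matrix (Fin n) (Fin n) D} (hA : A.IsHermitian) (hB : B.IsHermitian)
    (hA0 : A ≠ 0) (hB0 : B ≠ 0) (hAB : A ≠ B)
    (h1 : rowRank (A - B) ≠ 1) :
    ∃ X : Matrix (Fin n) (Fin n) D, X.IsHermitian ∧ (∀ v, v ᵥ* X = 0 → v = 0) ∧
      (∃ v, v ≠ 0 ∧ v ᵥ* (X - A) = 0) ∧ ∃ v, v ≠ 0 ∧ v ᵥ* (X - B) = 0 := by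
  by_cases hBA : ∃ x, x ᵥ* B = 0 ∧ x ᵥ* A ≠ 0
  · obtain ⟨x, hxB, hxA⟩ := hBA
    exact exists_isHermitian_of_ker_not_le hD hs hsc hA hB hB0 hxB hxA
  by_cases hAB' : ∃ x, x ᵥ* A = 0 ∧ x ᵥ* B ≠ 0
  · obtain ⟨x, hxA, hxB⟩ := hAB'
    obtain ⟨X, hX, hX0, h2, h3⟩ :=
      exists_isHermitian_of_ker_not_le hD hs hsc hB hA hA0 hxA hxB
    exact ⟨X, hX, hX0, h3, h2⟩
  push Not at hBA hAB'
  exact exists_isHermitian_of_ker_eq hD hs hsc hA hB hAB (fun x => ⟨hAB' x, hBA x⟩) h1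

/-- If `X - A` and `X - B` are singular and `R = A - B` has rank one, then `Y = X - P` is singular
for every other point `P = B + c • R` of the line through `A` and `B`. -/
theorem exists_vecMul_eq_zero_of_rowRank_eq_one {R Y : Matrix (Fin n) (Fin n) D}
    (hR : R.IsHermitian) (hY : Y.IsHermitian) (h1 : rowRank R = 1)
    {c : D} (hc : star c = c) (hcc : ∀ x, c * x = x * c) {u u' : Fin n → D}
    (hu : u ≠ 0) (hu' : u' ≠ 0) (huY : u ᵥ* Y = (1 - c) • (u ᵥ* R))
    (hu'Y : u' ᵥ* Y = (-c) • (u' ᵥ* R)) : ∃ v, v ≠ 0 ∧ v ᵥ* Y = 0 := by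
  by_cases huR : u ᵥ* R = 0
  · exact ⟨u, hu, by rw [huY, huR, smul_zero]⟩
  have h2 : sesqForm Y u u' = (1 - c) * sesqForm R u u' := by
    rw [sesqForm, huY, smul_dotProduct]; rfl
  have h3 : sesqForm Y u' u = (-c) * sesqForm R u' u := by
    rw [sesqForm, hu'Y, smul_dotProduct]; rfl
  have h4 := congrArg star h3
  rw [star_mul, sesqForm.star_eq hY, sesqForm.star_eq hR, h2, star_neg, hc, mul_neg, ← hcc,
    sub_mul, one_mul, sub_eq_neg_self] at h4
  obtain ⟨w, hw, hall⟩ := rowRank_eq_one_iff.mp h1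
  obtain ⟨a, ha⟩ := hall u
  have ha0 : a ≠ 0 := by
    rintro rfl
    exact huR (by rw [ha, zero_smul])
  have hwu' : sesqForm R w u' = 0 := by
    rw [sesqForm, ha, smul_dotProduct, smul_eq_mul, mul_eq_zero] at h4
    exact h4.resolve_left ha0
  refine ⟨u', hu', ?_⟩
  rw [hu'Y, sesqForm.vecMul_eq_zero (A := R) (v := u'), smul_zero]
  intro x
  rw [sesqForm.eq_zero_comm hR, sesqForm]
  obtain ⟨d, hd⟩ := hall x
  rw [hd, smul_dotProduct]
  exact (congrArg (d • ·) hwu').trans (smul_zero d)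

end Hermitian

section HermitianSpace

open Matrix

variable {D : Type*} [DivisionRing D] [StarRing D] {n : ℕ}

theorem exists_third_point_of_rowRank_eq_one
    {s : Finset D} (hs : 3 < s.card) (hsc : ∀ t ∈ s, star t = t ∧ ∀ x, t * x = x * t)
    (A B : {A : Matrix (Fin n) (Fin n) D // ∀ i j, star (A j i) = A i j})
    (h : rowRank (A.val - B.val) = 1) :
    ∃ P : {A : Matrix (Fin n) (Fin n) D // ∀ i j, star (A j i) = A i j}, P ≠ A ∧ P ≠ B ∧
      ∀ X : {A : Matrix (Fin n) (Fin n) D // ∀ i j, star (A j i) = A i j},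
        rowRank (X.val - P.val) = n →
          rowRank (X.val - A.val) = n ∨ rowRank (X.val - B.val) = n := by
  classical
  obtain ⟨c, hcs, hc⟩ : ∃ c ∈ s, c ∉ ({0, 1} : Finset D) :=
    Finset.exists_mem_notMem_of_card_lt_card (Finset.card_le_two.trans_lt (by omega))
  obtain ⟨hc0, hc1⟩ : c ≠ 0 ∧ c ≠ 1 := by simpa using hc
  obtain ⟨hst, hcc⟩ := hsc c hcs
  have hAB : A.val - B.val ≠ 0 := by
    intro h0
    rw [h0, rowRank_zero] at h
    exact zero_ne_one h
  have hA : A.val.IsHermitian := IsHermitian.ext A.2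
  have hB : B.val.IsHermitian := IsHermitian.ext B.2
  have hR := hA.sub hB
  have hP : (B.val + c • (A.val - B.val)).IsHermitian := by
    apply hB.add
    refine IsHermitian.ext fun i j => ?_
    rw [Matrix.smul_apply, Matrix.smul_apply, smul_eq_mul, star_mul, hst, hR.apply, ← hcc,
      smul_eq_mul]
  refine ⟨⟨B.val + c • (A.val - B.val), fun i j => hP.apply i j⟩, ?_, ?_, ?_⟩
  · intro h0
    have h1 : B.val + c • (A.val - B.val) = A.val := congrArg Subtype.val h0
    have h2 : (c - 1) • (A.val - B.val) = 0 := by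
      rw [sub_smul, one_smul, sub_eq_zero]
      exact eq_sub_iff_add_eq'.mpr h1
    exact (smul_ne_zero (sub_ne_zero.mpr hc1) hAB) h2
  · intro h0
    have h1 : B.val + c • (A.val - B.val) = B.val := congrArg Subtype.val h0
    exact (smul_ne_zero hc0 hAB) (add_eq_left.mp h1)
  · intro X hXP
    by_contra! hX
    obtain ⟨⟨u, hu, huX⟩, u', hu', hu'X⟩ :=
      And.imp rowRank_ne_card_iff.mp rowRank_ne_card_iff.mp hX
    have hsmul : ∀ v, v ᵥ* (c • (A.val - B.val)) = c • (v ᵥ* (A.val - B.val)) := by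
      intro v
      ext j
      simp only [vecMul, dotProduct, Matrix.smul_apply, Pi.smul_apply, smul_eq_mul, Finset.mul_sum]
      exact Finset.sum_congr rfl fun i _ => by rw [← mul_assoc, ← mul_assoc, hcc]
    refine rowRank_ne_card_iff.mpr ?_ hXP
    refine exists_vecMul_eq_zero_of_rowRank_eq_one hR
      ((IsHermitian.ext X.2).sub hP) h hst hcc hu hu' ?_ ?_
    · rw [show X.val - (B.val + c • (A.val - B.val)) =
        (X.val - A.val) + ((A.val - B.val) - c • (A.val - B.val)) by abel,
        vecMul_add, huX, zero_add, vecMul_sub, hsmul, sub_smul, one_smul]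
    · rw [show X.val - (B.val + c • (A.val - B.val)) =
        (X.val - B.val) - c • (A.val - B.val) by abel,
        vecMul_sub, hu'X, zero_sub, hsmul, neg_smul]

/-- Adjacency of Hermitian matrices in terms of pairs at maximal distance. -/
theorem rowRank_sub_eq_one_iff
    {s : Finset D} (hs : 3 < s.card) (hsc : ∀ t ∈ s, star t = t ∧ ∀ x, t * x = x * t)
    (hD : (∀ x : D, star x = x) → (2 : D) ≠ 0)
    (A B : {A : Matrix (Fin n) (Fin n) D // ∀ i j, star (A j i) = A i j}) :
    rowRank (A.val - B.val) = 1 ↔ A ≠ B ∧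
      ∃ P : {A : Matrix (Fin n) (Fin n) D // ∀ i j, star (A j i) = A i j}, P ≠ A ∧ P ≠ B ∧
      ∀ X : {A : Matrix (Fin n) (Fin n) D // ∀ i j, star (A j i) = A i j},
        rowRank (X.val - P.val) = n →
          rowRank (X.val - A.val) = n ∨ rowRank (X.val - B.val) = n := by
  constructor
  · refine fun h => ⟨?_, exists_third_point_of_rowRank_eq_one hs hsc A B h⟩
    rintro rfl
    rw [sub_self, rowRank_zero] at h
    exact zero_ne_one h
  · rintro ⟨hAB, P, hPA, hPB, h⟩
    by_contra h1
    have hP : P.val.IsHermitian := IsHermitian.ext P.2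
    have hne : ∀ {Q : {A : Matrix (Fin n) (Fin n) D // ∀ i j, star (A j i) = A i j}},
        P ≠ Q → Q.val - P.val ≠ 0 := fun hQ h0 => hQ (Subtype.ext (sub_eq_zero.mp h0).symm)
    obtain ⟨X, hX, hX0, hXA, hXB⟩ := exists_isHermitian_of_rowRank_ne_one hD hs hsc
      ((IsHermitian.ext A.2).sub hP) ((IsHermitian.ext B.2).sub hP) (hne hPA) (hne hPB)
      (fun h0 => hAB (Subtype.ext (sub_left_inj.mp h0)))
      (by rwa [sub_sub_sub_cancel_right])
    have hXP := hX.add hP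
    have hsub : ∀ Q : Matrix (Fin n) (Fin n) D, X - (Q - P.val) = X + P.val - Q := fun Q => by
      abel
    rw [hsub] at hXA hXB
    rcases h ⟨X + P.val, fun i j => hXP.apply i j⟩ (by
        rw [rowRank_eq_card_iff]
        simpa using hX0) with h2 | h2
    · exact rowRank_ne_card_iff.mpr hXA h2
    · exact rowRank_ne_card_iff.mpr hXB h2

theorem eq_of_forall_rowRank_sub_eq_card_iff
    (hD : (∀ x : D, star x = x) → (2 : D) ≠ 0)
    {A B : {A : Matrix (Fin n) (Fin n) D // ∀ i j, star (A j i) = A i j}}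
    (h : ∀ X : {A : Matrix (Fin n) (Fin n) D // ∀ i j, star (A j i) = A i j},
      rowRank (X.val - A.val) = n ↔ rowRank (X.val - B.val) = n) : A = B := by
  by_contra hAB
  have hA : A.val.IsHermitian := IsHermitian.ext A.2
  obtain ⟨X, hX, hX0, hXB⟩ := exists_isHermitian_of_ne_zero hD
    ((IsHermitian.ext B.2).sub hA)
    (fun h0 => hAB (Subtype.ext (sub_eq_zero.mp h0).symm))
  have hXA := hX.add hA
  refine rowRank_ne_card_iff.mpr hXB ?_
  rw [show X - (B.val - A.val) = X + A.val - B.val by abel]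
  refine (h ⟨X + A.val, fun i j => hXA.apply i j⟩).mp ?_
  rw [rowRank_eq_card_iff]
  simpa using hX0

theorem exists_chain (D : Type*) [DivisionRing D] [StarRing D] (n : ℕ) :
    ∃ f : ℕ → {A : Matrix (Fin n) (Fin n) D // ∀ i j, star (A j i) = A i j},
      (∀ k < n, rowRank ((f (k + 1)).val - (f k).val) = 1) ∧
      rowRank ((f n).val - (f 0).val) = n := by
  let d : ℕ → Fin n → D := fun k i => if i.val < k then 1 else 0
  have hd : ∀ k, star (d k) = d k := fun k => by
    ext i
    by_cases hi : i.val < k <;> simp [d, hi]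
  refine ⟨fun k => ⟨diagonal (d k), fun i j => ?_⟩, fun k hk => ?_, ?_⟩
  · have h : (diagonal (d k)).IsHermitian := by
      rw [IsHermitian, diagonal_conjTranspose, hd]
    exact h.apply i j
  · have hsub : d (k + 1) - d k = Pi.single ⟨k, hk⟩ 1 := by
      ext i
      simp only [Pi.single_apply, Pi.sub_apply, Fin.ext_iff]
      rcases lt_trichotomy i.val k with h | h | h
      · simp [d, h, h.ne, h.trans (Nat.lt_succ_self k)]
      · simp [d, h]
      · simp [d, h.ne', h.not_gt, (Nat.succ_le_of_lt h).not_gt]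
    have hv : ∀ v : Fin n → D, v ᵥ* (diagonal (d (k + 1)) - diagonal (d k)) =
        v ⟨k, hk⟩ • Pi.single ⟨k, hk⟩ 1 := by
      intro v
      rw [diagonal_sub, show (fun i => d (k + 1) i - d k i) = _ from hsub]
      ext j
      rw [vecMul_diagonal]
      by_cases hj : j = ⟨k, hk⟩ <;> simp [hj]
    rw [rowRank_eq_one_iff]
    refine ⟨Pi.single ⟨k, hk⟩ 1, ?_, fun v => ⟨v ⟨k, hk⟩, ?_⟩⟩
    · rw [hv]; simp
    · rw [hv, hv]; simp
  · rw [rowRank_eq_card_iff]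
    intro v hv
    have h : diagonal (d n) - diagonal (d 0) = (1 : Matrix (Fin n) (Fin n) D) := by
      rw [← diagonal_one, diagonal_sub]
      congr 1
      ext i
      simp [d]
    simpa only [h, vecMul_one] using hv

theorem bijective_and_rowRank_iff_of_surjective {D D' : Type*} [DivisionRing D] [DivisionRing D']
    [StarRing D] [StarRing D']
    (hD : (∀ x : D, star x = x) → (2 : D) ≠ 0) (hD' : (∀ x : D', star x = x) → (2 : D') ≠ 0)
    {s : Finset D} (hs : 3 < s.card) (hsc : ∀ t ∈ s, star t = t ∧ ∀ x, t * x = x * t)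
    {s' : Finset D'} (hs' : 3 < s'.card) (hsc' : ∀ t ∈ s', star t = t ∧ ∀ x, t * x = x * t)
    {n n' : ℕ}
    (φ : {A : Matrix (Fin n) (Fin n) D // ∀ i j, star (A j i) = A i j} →
         {A : Matrix (Fin n') (Fin n') D' // ∀ i j, star (A j i) = A i j})
    (hsurj : Function.Surjective φ)
    (hdiam : ∀ A B : {A : Matrix (Fin n) (Fin n) D // ∀ i j, star (A j i) = A i j},
      rowRank (A.val - B.val) = n ↔ rowRank ((φ A).val - (φ B).val) = n') :
    Function.Bijective φ ∧
    (∀ A B : {A : Matrix (Fin n) (Fin n) D // ∀ i j, star (A j i) = A i j},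
      rowRank (A.val - B.val) = 1 ↔ rowRank ((φ A).val - (φ B).val) = 1) ∧
    n = n' := by
  have hinj : Function.Injective φ := fun A B h =>
    eq_of_forall_rowRank_sub_eq_card_iff hD fun X => by rw [hdiam, hdiam, h]
  have hadj : ∀ A B : {A : Matrix (Fin n) (Fin n) D // ∀ i j, star (A j i) = A i j},
      rowRank (A.val - B.val) = 1 ↔ rowRank ((φ A).val - (φ B).val) = 1 := fun A B => by
    rw [rowRank_sub_eq_one_iff hs hsc hD, rowRank_sub_eq_one_iff hs' hsc' hD', hsurj.exists]
    simp only [hsurj.forall, hinj.ne_iff, hdiam]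
  refine ⟨⟨hinj, hsurj⟩, hadj, le_antisymm ?_ ?_⟩
  · obtain ⟨f, hf, hfn⟩ := exists_chain D' n'
    choose g hg using hsurj
    have h := rowRank_sub_le_of_chain (fun k => (g (f k)).val) n' fun k hk => by
      rw [hadj, hg, hg]
      exact hf k hk
    rwa [(hdiam _ _).mpr (by rwa [hg, hg])] at h
  · obtain ⟨f, hf, hfn⟩ := exists_chain D n
    have h := rowRank_sub_le_of_chain (fun k => (φ (f k)).val) n fun k hk =>
      (hadj _ _).mp (hf k hk)
    rwa [(hdiam _ _).mp hfn] at h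

end HermitianSpace

/-- Theorem 3.7 of the paper. `σ` and `σ'` are involutions of the
division rings `D` and `D'`, both subject to restrictions (R1) and (R2). A
surjection between the spaces of Hermitian matrices `H_n(D) → H_{n'}(D')`
preserving pairs at maximal rank-distance in both directions is bijective,
preserves adjacency in both directions, and `n = n'`. -/
theorem stmt_11 {D D' : Type*} [DivisionRing D] [DivisionRing D']
    (σ : D → D) (σ' : D' → D')
    (hadd : ∀ x y : D, σ (x + y) = σ x + σ y)
    (hmul : ∀ x y : D, σ (x * y) = σ y * σ x)
    (hinv : ∀ x : D, σ (σ x) = x)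
    (hR1 : ∃ s : Finset D, 3 < s.card ∧ ∀ x ∈ s, σ x = x ∧ x ∈ Subring.center D)
    (hR2 : σ = id → (2 : D) ≠ 0)
    (hadd' : ∀ x y : D', σ' (x + y) = σ' x + σ' y)
    (hmul' : ∀ x y : D', σ' (x * y) = σ' y * σ' x)
    (hinv' : ∀ x : D', σ' (σ' x) = x)
    (hR1' : ∃ s : Finset D', 3 < s.card ∧ ∀ x ∈ s, σ' x = x ∧ x ∈ Subring.center D')
    (hR2' : σ' = id → (2 : D') ≠ 0)
    {n n' : ℕ} (hn : 2 ≤ n) (hn' : 2 ≤ n')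
    (φ : {A : Matrix (Fin n) (Fin n) D // ∀ i j, σ (A j i) = A i j} →
         {A : Matrix (Fin n') (Fin n') D' // ∀ i j, σ' (A j i) = A i j})
    (hsurj : Function.Surjective φ)
    (hdiam : ∀ A B : {A : Matrix (Fin n) (Fin n) D // ∀ i j, σ (A j i) = A i j},
      rowRank (A.val - B.val) = n ↔ rowRank ((φ A).val - (φ B).val) = n') :
    Function.Bijective φ ∧
    (∀ A B : {A : Matrix (Fin n) (Fin n) D // ∀ i j, σ (A j i) = A i j},
      rowRank (A.val - B.val) = 1 ↔ rowRank ((φ A).val - (φ B).val) = 1) ∧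
    n = n' := by
  let _ : StarRing D :=
    { star := σ, star_involutive := hinv, star_mul := hmul, star_add := hadd }
  let _ : StarRing D' :=
    { star := σ', star_involutive := hinv', star_mul := hmul', star_add := hadd' }
  obtain ⟨s, hs, hsc⟩ := hR1
  obtain ⟨s', hs', hsc'⟩ := hR1'
  exact bijective_and_rowRank_iff_of_surjective (fun h => hR2 (funext h))
    (fun h => hR2' (funext h)) hs
    (fun t ht => ⟨(hsc t ht).1, fun x => (Subring.mem_center_iff.mp (hsc t ht).2 x).symm⟩) hs'
    (fun t ht => ⟨(hsc' t ht).1, fun x => (Subring.mem_center_iff.mp (hsc' t ht).2 x).symm⟩)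
    φ hsurj hdiam
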